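/- Let F = (f₁,…,f_p) ∈ ℤ[X₁,…,X_n]^p such that the ideal ⟨f₁,…,f_p⟩ ⊆ ℂ[X₁,…,X_n] is radical, every minimal prime over ⟨f₁,…,f_p⟩ has height p, and jac(F)(x) has rank p at every x ∈ V(F). Let 𝔄 be an n×n matrix of independent indeterminates, K = ℂ(𝔄_{k,m} : 1≤k,m≤n), F^𝔄 = (f₁(𝔄X),…,f_p(𝔄X)) ∈ K[X₁,…,X_n]^p, fix i ∈ {1,…,n−p+1}, and let 𝒦 be the ideal generated by 𝔍(i,F^𝔄) in K[X₁,…,X_n]. Then: (a) for each j ∈ {i,…,n} there exists a polynomial Q_j ∈ K[X₁,…,X_{i−1},X_j], monic as a polynomial in X_j, with Q_j ∈ √𝒦; and (b) every minimal prime 𝔓 over 𝒦 in K[X₁,…,X_n] satisfies 𝔓 ∩ K[X₁,…,X_{i−1}] = {0}. -/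

import Mathlib

open MvPolynomial

noncomputable section

/-- The Jacobian matrix, evaluated at a point. -/
def jacEval {ι σ : Type*} [Fintype ι] [Fintype σ]
    (G : ι → MvPolynomial σ ℂ) (y : σ → ℂ) : Matrix ι σ ℂ :=
  Matrix.of fun j k => eval y (pderiv k (G j))

/-- The ideal `P` is prime of height `c`. -/
def IdealHeightEq {R : Type*} [CommRing R] (P : Ideal R) (c : ℕ) : Prop :=
  ∃ hP : P.IsPrime, Order.height (⟨P, hP⟩ : PrimeSpectrum R) = (c : ℕ∞)

/-- The complexification of an integer polynomial. -/
def toC {n : ℕ} (f : MvPolynomial (Fin n) ℤ) : MvPolynomial (Fin n) ℂ :=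
  map (Int.castRingHom ℂ) f

/-- `K = ℂ(𝔄_{k,m})`, the field of rational functions in the `n²` entries of a
generic `n × n` matrix `𝔄`. -/
abbrev GenField (n : ℕ) : Type :=
  FractionRing (MvPolynomial (Fin n × Fin n) ℂ)

/-- The generic-matrix entry `𝔄_{k,m}` as an element of `K`. -/
def genEntry (n : ℕ) (k m : Fin n) : GenField n :=
  algebraMap (MvPolynomial (Fin n × Fin n) ℂ) (GenField n) (X (k, m))

/-- `f^𝔄 = f(𝔄·X) ∈ K[X₁,…,X_n]` for an integer polynomial `f`. -/
def genChange {n : ℕ} (f : MvPolynomial (Fin n) ℤ) : MvPolynomial (Fin n) (GenField n) :=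
  aeval (fun k : Fin n => ∑ m : Fin n, C (genEntry n k m) * X m)
    (map (Int.castRingHom (GenField n)) f)

/-- The index (as an element of `Fin n`) of the `c`-th of the last `n - i` variables. -/
def colIdx (n i : ℕ) (c : Fin (n - i)) : Fin n :=
  ⟨i + c, by have := c.isLt; omega⟩

/-- The ideal `⟨𝔍(i,G)⟩` generated by `G` and the `p × p` minors of `jac(G, i)`,
over any coefficient ring. -/
def polarIdealK {R : Type*} [CommRing R] {n p : ℕ}
    (G : Fin p → MvPolynomial (Fin n) R) (i : ℕ) : Ideal (MvPolynomial (Fin n) R) :=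
  Ideal.span (Set.range G ∪
    {g | ∃ c : Fin p ↪ Fin (n - i),
      g = Matrix.det (Matrix.of fun a b : Fin p => pderiv (colIdx n i (c b)) (G a))})

open scoped TensorProduct

lemma exists_derivation_extending {R S T M : Type*} [CommRing R] [CommRing S] [CommRing T]
    [Algebra R S] [Algebra S T] [Algebra R T] [IsScalarTower R S T] [Algebra.FormallyEtale S T]
    [AddCommGroup M] [Module R M] [Module S M] [Module T M] [IsScalarTower S T M]
    [IsScalarTower R S M] [IsScalarTower R T M]
    (d : Derivation R S M) :
    ∃ D : Derivation R T M, ∀ s, D (algebraMap S T s) = d s := by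
  let l : T ⊗[S] (Ω[S⁄R]) →ₗ[T] M := LinearMap.liftBaseChange T d.liftKaehlerDifferential
  refine ⟨(l ∘ₗ (KaehlerDifferential.tensorKaehlerEquivOfFormallyEtale R S
    T).symm.toLinearMap).compDer
    (KaehlerDifferential.D R T), fun s => ?_⟩
  simp [l, KaehlerDifferential.tensorKaehlerEquivOfFormallyEtale_symm_D_algebraMap]

lemma formallyEtale_of_isAlgebraic {S L : Type*} [CommRing S] [IsDomain S] [CharZero S] [Field L]
    [Algebra S L] [FaithfulSMul S L] [Algebra.IsAlgebraic S L] : Algebra.FormallyEtale S L := by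
  let F := FractionRing S
  let : Algebra F L := FractionRing.liftAlgebra S L
  have : IsScalarTower S F L := inferInstance
  have : Algebra.IsAlgebraic F L := .extendScalars (IsFractionRing.injective S F)
  have : Algebra.FormallyEtale S F := .of_isLocalization (nonZeroDivisors S)
  have : CharZero F := inferInstance
  have : Algebra.FormallyEtale F L := Algebra.FormallyEtale.of_isSeparable F L
  exact .comp S F L

lemma IsTranscendenceBasis.exists_derivation {K L ι : Type*} [Field K] [Field L] [CharZero K]
    [Algebra K L] {x : ι → L} (hx : IsTranscendenceBasis K x) (v : ι → L) :
    ∃ D : Derivation K L L, ∀ i, D (x i) = v i := by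
  let : Algebra (MvPolynomial ι K) L := (aeval (R := K) x).toRingHom.toAlgebra
  have hmap (s : MvPolynomial ι K) : algebraMap (MvPolynomial ι K) L s = aeval x s := rfl
  have : IsScalarTower K (MvPolynomial ι K) L := .of_algebraMap_eq fun r => by simp [hmap]
  have : FaithfulSMul (MvPolynomial ι K) L := (faithfulSMul_iff_algebraMap_injective _ L).2 hx.1
  have halg : Algebra.IsAlgebraic (Algebra.adjoin K (Set.range x)) L := hx.isAlgebraic
  let e := hx.1.aevalEquiv
  have : Algebra.IsAlgebraic (MvPolynomial ι K) L := by
    refine halg.ringHom_of_comp_eq (e.symm : _ →+* MvPolynomial ι K) (RingHom.id L)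
      e.symm.injective Function.surjective_id ?_
    ext s
    obtain ⟨q, rfl⟩ := e.surjective s
    simp [hmap, e]
  have : Algebra.FormallyEtale (MvPolynomial ι K) L := formallyEtale_of_isAlgebraic
  obtain ⟨D, hD⟩ := exists_derivation_extending (T := L)
    (mkDerivation K v : Derivation K (MvPolynomial ι K) L)
  refine ⟨D, fun i => ?_⟩
  simpa [hmap] using hD (X i)

lemma AlgebraicIndependent.exists_derivation {K L ι : Type*} [Field K] [Field L] [CharZero K]
    [Algebra K L] {x : ι → L} (hx : AlgebraicIndependent K x) (v : ι → L) :
    ∃ D : Derivation K L L, ∀ i, D (x i) = v i := by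
  classical
  obtain ⟨t, hst, ht⟩ := exists_isTranscendenceBasis_superset
    (AlgebraicIndependent.coe_range hx)
  let w : t → L := fun y => if h : ∃ i, x i = y then v h.choose else 0
  obtain ⟨D, hD⟩ := ht.exists_derivation w
  refine ⟨D, fun i => ?_⟩
  have h : ∃ j, x j = x i := ⟨i, rfl⟩
  rw [hD ⟨x i, hst ⟨i, rfl⟩⟩]
  simp only [w, h, dif_pos]
  rw [hx.injective h.choose_spec]

lemma exists_vecMul_eq_zero_of_minors {L ι κ : Type*} [Field L] [Fintype ι] [DecidableEq ι]
    [Fintype κ] (M : Matrix ι κ L) (h : ∀ c : ι ↪ κ, (M.submatrix id c).det = 0) :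
    ∃ l : ι → L, l ≠ 0 ∧ Matrix.vecMul l M = 0 := by
  by_contra! hcon
  have hli : LinearIndependent L M.row := by
    rw [← Matrix.vecMul_injective_iff]
    intro a b hab
    by_contra hne
    exact hcon (a - b) (sub_ne_zero.2 hne) (by rw [Matrix.sub_vecMul]; exact sub_eq_zero.2 hab)
  have hr : M.rank = Fintype.card ι := hli.rank_matrix
  rw [Matrix.rank_eq_finrank_span_cols] at hr
  obtain ⟨f, hf, -, hfi⟩ := Submodule.exists_fun_fin_finrank_span_eq L (Set.range M.col)
  choose g hg using hf
  let e : ι ≃ Fin _ := (Fintype.equivFin ι).trans (finCongr hr.symm)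
  have hfi' : LinearIndependent L (fun k => f (e k)) := hfi.comp _ e.injective
  let c : ι ↪ κ := ⟨fun k => g (e k), fun a b hab =>
    hfi'.injective (by simpa only [hg] using congrArg M.col hab)⟩
  have hunit : IsUnit (M.submatrix id c) := by
    rw [← Matrix.linearIndependent_cols_iff_isUnit]
    convert hfi' using 1
    ext k a
    rw [← hg]
    rfl
  exact ((Matrix.isUnit_iff_isUnit_det _).1 hunit).ne_zero (h c)

/-- The ideal generated by the maximal minors (of size the number of rows). -/
def minorIdeal {R ι κ : Type*} [CommRing R] [Fintype ι] [DecidableEq ι] (M : Matrix ι κ R) :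
    Ideal R :=
  Ideal.span (Set.range fun c : ι ↪ κ => (M.submatrix id c).det)

lemma minorIdeal_le_iff {R ι κ : Type*} [CommRing R] [Fintype ι] [DecidableEq ι] [Fintype κ]
    (M : Matrix ι κ R) (Q : Ideal R) [Q.IsPrime] :
    minorIdeal M ≤ Q ↔ ∃ l : ι → R, (∃ a, l a ∉ Q) ∧ ∀ b, ∑ a, l a * M a b ∈ Q := by
  constructor
  · intro h
    let L := FractionRing (R ⧸ Q)
    let φ : R →+* L := (algebraMap (R ⧸ Q) L).comp (Ideal.Quotient.mk Q)
    have hφ (r : R) : φ r = 0 ↔ r ∈ Q := by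
      simp [φ, Ideal.Quotient.eq_zero_iff_mem]
    obtain ⟨l, hl, hl'⟩ := exists_vecMul_eq_zero_of_minors (M.map φ) fun c => by
      have := (hφ _).2 (h (Ideal.subset_span ⟨c, rfl⟩))
      rwa [RingHom.map_det] at this
    obtain ⟨d, hd⟩ := IsLocalization.exist_integer_multiples_of_finite (nonZeroDivisors (R ⧸ Q)) l
    choose l' hl'' using hd
    choose m hm using fun a => Ideal.Quotient.mk_surjective (l' a)
    have hm' (a : ι) : φ (m a) = algebraMap (R ⧸ Q) L d * l a := by
      simp [φ, hm, hl'', Algebra.smul_def]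
    have hd0 : algebraMap (R ⧸ Q) L d ≠ 0 := by
      simp
    refine ⟨m, ?_, fun b => ?_⟩
    · obtain ⟨a, ha⟩ := Function.ne_iff.1 hl
      exact ⟨a, fun h => mul_ne_zero hd0 ha ((hm' a).symm.trans ((hφ _).2 h))⟩
    · rw [← hφ]
      have := congrFun hl' b
      simp only [Matrix.vecMul, dotProduct, Matrix.map_apply, Pi.zero_apply] at this
      simp [hm', mul_assoc, ← Finset.mul_sum, this]
  · rintro ⟨l, ⟨a, ha⟩, hl⟩
    refine Ideal.span_le.2 ?_
    rintro _ ⟨c, rfl⟩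
    refine (Ideal.IsPrime.mem_or_mem ‹_› (y := l a) ?_).resolve_right ha
    have h1 : Matrix.vecMul (Matrix.vecMul l (M.submatrix id c)) (M.submatrix id c).adjugate a
        = (M.submatrix id c).det * l a := by
      rw [Matrix.vecMul_vecMul, Matrix.mul_adjugate]
      simp [Matrix.vecMul_smul]
    rw [← h1]
    exact Q.sum_mem fun b _ => Q.mul_mem_right _ (hl (c b))

lemma minorIdeal_le_iff_schur {R ι κ : Type*} [CommRing R] [Fintype ι] [DecidableEq ι] [Fintype κ]
    [DecidableEq κ] (M : Matrix ι κ R) (a₀ : ι) (b₀ : κ) (Q : Ideal R) [Q.IsPrime]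
    (hQ : M a₀ b₀ ∉ Q) :
    minorIdeal M ≤ Q ↔ minorIdeal (Matrix.of fun (a : {a // a ≠ a₀}) (b : {b // b ≠ b₀}) =>
      M a b * M a₀ b₀ - M a b₀ * M a₀ b) ≤ Q := by
  rw [minorIdeal_le_iff, minorIdeal_le_iff]
  constructor
  · rintro ⟨l, ⟨a, ha⟩, hl⟩
    have hsplit (b : κ) : ∑ c : {c // c ≠ a₀}, l c * M c b = ∑ c, l c * M c b - l a₀ * M a₀ b := by
      rw [Fintype.sum_eq_add_sum_subtype_ne _ a₀]
      ring
    refine ⟨fun c => l c, ?_, fun b => ?_⟩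
    · by_contra! hc
      have h1 : ∑ c : {c // c ≠ a₀}, l c * M c b₀ ∈ Q :=
        Q.sum_mem fun c _ => Q.mul_mem_right _ (hc c)
      have h2 : l a₀ * M a₀ b₀ ∈ Q := by
        have := Q.sub_mem (hl b₀) h1
        rwa [hsplit, sub_sub_cancel] at this
      have h3 := (Ideal.IsPrime.mem_or_mem ‹_› h2).resolve_right hQ
      by_cases h : a = a₀
      · exact ha (h ▸ h3)
      · exact ha (hc ⟨a, h⟩)
    · have : ∑ c : {c // c ≠ a₀}, l c * (M c b * M a₀ b₀ - M c b₀ * M a₀ b)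
          = (∑ c, l c * M c b) * M a₀ b₀ - (∑ c, l c * M c b₀) * M a₀ b := by
        have h1 : ∑ c : {c // c ≠ a₀}, l c * (M c b * M a₀ b₀ - M c b₀ * M a₀ b)
            = (∑ c : {c // c ≠ a₀}, l c * M c b) * M a₀ b₀
              - (∑ c : {c // c ≠ a₀}, l c * M c b₀) * M a₀ b := by
          rw [Finset.sum_mul, Finset.sum_mul, ← Finset.sum_sub_distrib]
          exact Finset.sum_congr rfl fun c _ => by ring
        rw [h1, hsplit, hsplit]
        ring
      simp only [Matrix.of_apply]
      rw [this]
      exact Q.sub_mem (Q.mul_mem_right _ (hl b)) (Q.mul_mem_right _ (hl b₀))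
  · rintro ⟨l, ⟨a, ha⟩, hl⟩
    let m : ι → R := fun c => if h : c = a₀ then -∑ c : {c // c ≠ a₀}, l c * M c b₀
      else l ⟨c, h⟩ * M a₀ b₀
    have hm (c : {c // c ≠ a₀}) : m c = l c * M a₀ b₀ := by simp [m, c.2]
    refine ⟨m, ⟨a, ?_⟩, fun b => ?_⟩
    · rw [hm]
      exact fun h => (Ideal.IsPrime.mem_or_mem ‹_› h).elim ha hQ
    · have : ∑ c, m c * M c b = ∑ c : {c // c ≠ a₀}, l c * (M c b * M a₀ b₀ - M c b₀ * M a₀ b) := by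
        rw [Fintype.sum_eq_add_sum_subtype_ne _ a₀]
        simp only [hm]
        simp only [m, dif_pos, neg_mul, Finset.sum_mul]
        rw [neg_add_eq_sub, ← Finset.sum_sub_distrib]
        exact Finset.sum_congr rfl fun c _ => by ring
      rw [this]
      by_cases hb : b = b₀
      · subst hb
        simp [mul_comm]
      · exact hl ⟨b, hb⟩

lemma Ideal.height_le_height_map_C {R : Type*} [CommRing R] [IsNoetherianRing R] (P : Ideal R)
    [P.IsPrime] : P.height ≤ (P.map (Polynomial.C : R →+* Polynomial R)).height := by
  have : (P.map (Polynomial.C : R →+* Polynomial R)).LiesOver P :=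
    ⟨by ext x; simp [Ideal.mem_map_C_iff, Polynomial.coeff_C, ite_mem]⟩
  rw [Ideal.height_eq_height_add_of_liesOver_of_hasGoingDown P
    (P.map (Polynomial.C : R →+* Polynomial R))]
  exact le_self_add

lemma height_le_of_mem_minimalPrimes_minorIdeal_of_entry_notMem {R ι κ : Type*} [CommRing R]
    [Fintype ι] [DecidableEq ι] [Fintype κ] [DecidableEq κ] (M : Matrix ι κ R)
    {P : Ideal R} (hP : P ∈ (minorIdeal M).minimalPrimes) {a₀ : ι} {b₀ : κ} (h : M a₀ b₀ ∉ P)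
    (ih : ∀ N : Matrix {a // a ≠ a₀} {b // b ≠ b₀} R, ∀ P ∈ (minorIdeal N).minimalPrimes,
      P.height ≤ ((Fintype.card {b // b ≠ b₀} + 1 - Fintype.card {a // a ≠ a₀} : ℕ) : ℕ∞)) :
    P.height ≤ ((Fintype.card κ + 1 - Fintype.card ι : ℕ) : ℕ∞) := by
  have hPp : P.IsPrime := hP.isPrime
  have hι : 0 < Fintype.card ι := Fintype.card_pos_iff.2 ⟨a₀⟩
  have hκ : 0 < Fintype.card κ := Fintype.card_pos_iff.2 ⟨b₀⟩
  have hcard : Fintype.card κ + 1 - Fintype.card ι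
      = Fintype.card {b // b ≠ b₀} + 1 - Fintype.card {a // a ≠ a₀} := by
    simp only [ne_eq, Fintype.card_subtype_compl, Fintype.card_subtype_eq]
    omega
  rw [hcard]
  refine ih (Matrix.of fun a b => M a b * M a₀ b₀ - M a b₀ * M a₀ b) P
    ⟨⟨hPp, (minorIdeal_le_iff_schur M a₀ b₀ P h).1 hP.le⟩, fun Q ⟨hQ, hNQ⟩ hQP => ?_⟩
  exact hP.2 ⟨hQ, (minorIdeal_le_iff_schur M a₀ b₀ Q fun hQ' => h (hQP hQ')).2 hNQ⟩ hQP

lemma Ideal.eq_of_mem_minimalPrimes_sup_span_singleton {R : Type*} [CommRing R]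
    [IsNoetherianRing R] {P Q T : Ideal R} {x : R} [P.IsPrime] [Q.IsPrime]
    (hT : T ∈ (Q ⊔ Ideal.span {x}).minimalPrimes) (hQP : Q ≤ P) (hPT : P < T) : Q = P := by
  have hTp : T.IsPrime := hT.isPrime
  have hQT : Q ≤ T := hQP.trans hPT.le
  have h1 := Ideal.map_height_le_one_of_mem_minimalPrimes hT
  have : (P.map (Ideal.Quotient.mk Q)).IsPrime := Ideal.isPrime_map_quotientMk_of_isPrime hQP
  have : (T.map (Ideal.Quotient.mk Q)).IsPrime := Ideal.isPrime_map_quotientMk_of_isPrime hQT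
  have hlt : P.map (Ideal.Quotient.mk Q) < T.map (Ideal.Quotient.mk Q) := by
    refine lt_of_le_of_ne (Ideal.map_mono hPT.le) fun h => hPT.ne ?_
    have := congrArg (Ideal.comap (Ideal.Quotient.mk Q)) h
    simpa [Ideal.comap_map_of_surjective _ Ideal.Quotient.mk_surjective, ← RingHom.ker_eq_comap_bot,
      hQP, hQT] using this
  have h2 := (Ideal.height_add_one_le_of_lt_of_isPrime hlt).trans h1
  have h3 : (P.map (Ideal.Quotient.mk Q)).height = 0 := by
    rw [← zero_add (1 : ℕ∞)] at h2
    exact nonpos_iff_eq_zero.1 ((ENat.add_le_add_iff_right ENat.one_ne_top).1 h2)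
  rw [Ideal.height_eq_zero_iff_eq_bot, Ideal.map_eq_bot_iff_le_ker, Ideal.mk_ker] at h3
  exact le_antisymm hQP h3

/-- **Macaulay's bound** for determinantal ideals of maximal minors. -/
theorem height_le_of_mem_minimalPrimes_minorIdeal {R ι κ : Type*} [CommRing R] [IsNoetherianRing R]
    [Fintype ι] [DecidableEq ι] [Fintype κ] [DecidableEq κ] (M : Matrix ι κ R)
    {P : Ideal R} (hP : P ∈ (minorIdeal M).minimalPrimes) :
    P.height ≤ ((Fintype.card κ + 1 - Fintype.card ι : ℕ) : ℕ∞) := by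
  induction hd : Fintype.card ι generalizing R ι κ with
  | zero =>
    have hPp : P.IsPrime := hP.isPrime
    obtain ⟨l, ⟨a, -⟩, -⟩ := (minorIdeal_le_iff M P).1 hP.le
    exact absurd hd (Fintype.card_pos_iff.2 ⟨a⟩).ne'
  | succ d ih =>
    have hPp : P.IsPrime := hP.isPrime
    have key {S : Type _} [CommRing S] [IsNoetherianRing S] (M : Matrix ι κ S) {P : Ideal S}
        (hP : P ∈ (minorIdeal M).minimalPrimes) {a₀ : ι} {b₀ : κ} (h : M a₀ b₀ ∉ P) :
        P.height ≤ ((Fintype.card κ + 1 - (d + 1) : ℕ) : ℕ∞) := by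
      rw [← hd]
      have hd' : Fintype.card {a // a ≠ a₀} = d := by
        simp only [ne_eq, Fintype.card_subtype_compl, Fintype.card_subtype_eq]
        omega
      refine height_le_of_mem_minimalPrimes_minorIdeal_of_entry_notMem M hP h fun N P hP => ?_
      rw [hd']
      exact ih N hP hd'
    by_cases hM : ∃ a b, M a b ∉ P
    · obtain ⟨a, b, hab⟩ := hM
      exact key M hP hab
    push Not at hM
    have hιne : Nonempty ι := Fintype.card_pos_iff.1 (by omega)
    obtain ⟨a₁⟩ := hιne
    by_cases hd1 : d = 0
    · have : Unique ι := (Fintype.card_eq_one_iff_nonempty_unique.1 (by omega)).some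
      have hfin : (Set.range (M a₁)).Finite := Set.finite_range _
      have hP' : P ∈ (Ideal.span (Set.range (M a₁))).minimalPrimes := by
        refine ⟨⟨hPp, Ideal.span_le.2 ?_⟩, fun Q ⟨hQ, hMQ⟩ hQP => hP.2 ⟨hQ, ?_⟩ hQP⟩
        · rintro _ ⟨b, rfl⟩
          exact hM a₁ b
        · refine (minorIdeal_le_iff M Q).2 ⟨1, ⟨a₁, Q.one_notMem⟩, fun b => ?_⟩
          simpa [Unique.eq_default a₁] using hMQ (Ideal.subset_span ⟨b, rfl⟩)
      refine (Ideal.height_le_card_of_mem_minimalPrimes_span hfin hP').trans ?_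
      have := Finite.card_range_le (M a₁)
      rw [Nat.card_coe_set_eq, Nat.card_eq_fintype_card] at this
      exact_mod_cast this.trans (by omega)
    rcases isEmpty_or_nonempty κ with hκ | ⟨⟨b₀⟩⟩
    · have hbot : minorIdeal M = ⊥ := by
        rw [minorIdeal, Ideal.span_eq_bot]
        rintro _ ⟨c, -⟩
        exact isEmptyElim (c a₁)
      rw [hbot] at hP
      rw [Ideal.height_eq_zero_iff.2 hP]
      exact zero_le
    obtain ⟨a₀, ha₀⟩ : ∃ a₀, a₀ ≠ a₁ := by
      have : Nontrivial ι := Fintype.one_lt_card_iff_nontrivial.1 (by omega)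
      exact exists_ne a₁
    let M' : Matrix ι κ (Polynomial R) := Matrix.of fun a b =>
      Polynomial.C (M a b) + if a = a₀ ∧ b = b₀ then Polynomial.X else 0
    let P₁ := P.map (Polynomial.C : R →+* Polynomial R)
    let ev : Polynomial R →+* R := Polynomial.evalRingHom 0
    let Q₀ := P.comap ev
    have hXQ₀ : Polynomial.X ∈ Q₀ := by simp [Q₀, ev]
    have hP₁Q₀ : P₁ < Q₀ := by
      refine lt_of_le_of_ne (Ideal.map_le_iff_le_comap.2 fun x hx => ?_) fun h => ?_
      · simpa [Q₀, ev] using hx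
      · rw [← h, Ideal.mem_map_C_iff] at hXQ₀
        exact P.one_notMem (by simpa using hXQ₀ 1)
    have hevM : M'.map ev = M := by
      ext a b
      simp only [M', ev, Matrix.map_apply, Matrix.of_apply]
      split_ifs <;> simp
    have hM'P₁ : minorIdeal M' ≤ P₁ := by
      refine (minorIdeal_le_iff M' P₁).2 ⟨Pi.single a₁ 1, ⟨a₁, ?_⟩, fun b => ?_⟩
      · simpa using P₁.one_notMem
      · simpa [Pi.single_apply, M', ha₀.symm] using Ideal.mem_map_of_mem _ (hM a₁ b)
    obtain ⟨Q₁, hQ₁, hQ₁P₁⟩ := Ideal.exists_minimalPrimes_le hM'P₁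
    have hQ₁p : Q₁.IsPrime := hQ₁.isPrime
    have hQ₀ : Q₀ ∈ (Q₁ ⊔ Ideal.span {Polynomial.X}).minimalPrimes := by
      refine ⟨⟨inferInstance, sup_le (hQ₁P₁.trans hP₁Q₀.le)
        ((Ideal.span_singleton_le_iff_mem _).2 hXQ₀)⟩, fun Q ⟨hQ, hle⟩ hQQ₀ f hf => ?_⟩
      have hXQ : Polynomial.X ∈ Q := hle (Ideal.mem_sup_right (Ideal.mem_span_singleton_self _))
      have hev (f : Polynomial R) : f ∈ Q ↔ Polynomial.C (ev f) ∈ Q := by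
        conv_lhs => rw [← Polynomial.divX_mul_X_add f]
        rw [Q.add_mem_iff_right (Q.mul_mem_left _ hXQ)]
        simp [ev, Polynomial.coeff_zero_eq_eval_zero]
      refine (hev f).2 (hP.2 (y := Q.comap Polynomial.C) ⟨inferInstance, ?_⟩ (fun x hx => ?_) hf)
      · refine Ideal.span_le.2 ?_
        rintro _ ⟨c, rfl⟩
        have := (hev _).1 (hle (Ideal.mem_sup_left (hQ₁.le (Ideal.subset_span ⟨c, rfl⟩))))
        rw [RingHom.map_det] at this
        rwa [← hevM]
      · simpa [Q₀, ev] using hQQ₀ hx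
    obtain rfl := Ideal.eq_of_mem_minimalPrimes_sup_span_singleton hQ₀ hQ₁P₁ hP₁Q₀
    refine P.height_le_height_map_C.trans (key M' hQ₁ (a₀ := a₀) (b₀ := b₀) fun h => ?_)
    have := Ideal.mem_map_C_iff.1 h 1
    exact P.one_notMem (by simpa [M', Polynomial.coeff_C] using this)

lemma Ideal.height_comap_C_add_one_le {R : Type*} [CommRing R] [IsNoetherianRing R]
    (Q : Ideal (Polynomial R)) [Q.IsPrime] {g : Polynomial R} (hg : g.Monic) (hgQ : g ∈ Q) :
    (Q.comap Polynomial.C).height + 1 ≤ Q.height := by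
  have hlt : (Q.comap Polynomial.C).map Polynomial.C < Q := by
    refine lt_of_le_of_ne Ideal.map_comap_le fun h => ?_
    rw [← h, Ideal.mem_map_C_iff] at hgQ
    refine (Q.comap Polynomial.C).one_notMem ?_
    rw [← hg.coeff_natDegree]
    exact hgQ g.natDegree
  exact (add_le_add_left (Ideal.height_le_height_map_C _) 1).trans
    (Ideal.height_add_one_le_of_lt_of_isPrime hlt)

/-- Polynomials in `s + 1` variables as univariate polynomials in the last variable. -/
def MvPolynomial.finSuccEquivLast (K : Type*) [CommRing K] (s : ℕ) :
    MvPolynomial (Fin (s + 1)) K ≃ₐ[K] Polynomial (MvPolynomial (Fin s) K) :=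
  (renameEquiv K _root_.finSuccEquivLast).trans (optionEquivLeft K (Fin s))

lemma MvPolynomial.finSuccEquivLast_X_castSucc {K : Type*} [CommRing K] {s : ℕ} (k : Fin s) :
    MvPolynomial.finSuccEquivLast K s (X k.castSucc) = Polynomial.C (X k) := by
  simp [MvPolynomial.finSuccEquivLast]

lemma MvPolynomial.finSuccEquivLast_X_last {K : Type*} [CommRing K] {s : ℕ} :
    MvPolynomial.finSuccEquivLast K s (X (Fin.last s)) = Polynomial.X := by
  simp [MvPolynomial.finSuccEquivLast]

lemma MvPolynomial.finSuccEquivLast_rename {K : Type*} [CommRing K] {s : ℕ}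
    (q : MvPolynomial (Fin s) K) :
    MvPolynomial.finSuccEquivLast K s (rename Fin.castSucc q) = Polynomial.C q := by
  induction q using MvPolynomial.induction_on with
  | C a => simp [MvPolynomial.finSuccEquivLast]
  | add p q hp hq => simp [hp, hq]
  | mul_X p k hp => simp [hp, finSuccEquivLast_X_castSucc]

lemma Ideal.height_comap_rename_castSucc_add_one_le {K : Type*} [Field K] {s : ℕ}
    (Q : Ideal (MvPolynomial (Fin (s + 1)) K)) [Q.IsPrime]
    {g : Polynomial (MvPolynomial (Fin s) K)} (hg : g.Monic)
    (hgQ : Polynomial.eval₂ (rename Fin.castSucc).toRingHom (X (Fin.last s)) g ∈ Q) :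
    (Q.comap (rename Fin.castSucc).toRingHom).height + 1 ≤ Q.height := by
  let e := MvPolynomial.finSuccEquivLast K s
  have hC (q : MvPolynomial (Fin s) K) : e.symm (Polynomial.C q) = rename Fin.castSucc q := by
    rw [AlgEquiv.symm_apply_eq, MvPolynomial.finSuccEquivLast_rename]
  have he : (e.symm : Polynomial (MvPolynomial (Fin s) K) →+* MvPolynomial (Fin (s + 1)) K) =
      Polynomial.eval₂RingHom (rename Fin.castSucc).toRingHom
      (X (Fin.last s)) := by
    refine Polynomial.ringHom_ext (fun a => ?_) ?_
    · simp [hC]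
    · simp [e, AlgEquiv.symm_apply_eq, MvPolynomial.finSuccEquivLast_X_last]
  let Q' := Q.comap (e.symm : Polynomial (MvPolynomial (Fin s) K) →+* MvPolynomial (Fin (s + 1)) K)
  have h1 : Q'.height = Q.height := e.symm.toRingEquiv.height_comap Q
  have h2 : Q'.comap Polynomial.C = Q.comap (rename Fin.castSucc).toRingHom := by
    ext q
    simp [Q', hC]
  rw [← h1, ← h2]
  refine Ideal.height_comap_C_add_one_le Q' hg ?_
  simpa [Q', he] using hgQ

lemma Ideal.le_height_of_comap_rename_ne_bot {K : Type*} [Field K] {n r : ℕ} (hr : r ≤ n)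
    (P : Ideal (MvPolynomial (Fin n) K)) [P.IsPrime]
    (hmonic : ∀ j : Fin n, r ≤ j → ∃ g : Polynomial (MvPolynomial (Fin r) K), g.Monic ∧
      Polynomial.eval₂ (rename (Fin.castLE hr)).toRingHom (X j) g ∈ P)
    (hP : P.comap (rename (Fin.castLE hr) : MvPolynomial (Fin r) K →ₐ[K] _).toRingHom ≠ ⊥) :
    ((n - r + 1 : ℕ) : ℕ∞) ≤ P.height := by
  have key (s : ℕ) (hrs : r ≤ s) (hsn : s ≤ n) : ((s - r + 1 : ℕ) : ℕ∞) ≤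
      (P.comap (rename (Fin.castLE hsn) : MvPolynomial (Fin s) K →ₐ[K] _).toRingHom).height := by
    induction s, hrs using Nat.le_induction with
    | base =>
      simp only [tsub_self, zero_add, Nat.cast_one, Order.one_le_iff_ne_zero]
      rwa [Ne, Ideal.height_eq_zero_iff_eq_bot]
    | succ s hrs ih =>
      obtain ⟨g, hg, hgP⟩ := hmonic ⟨s, hsn⟩ hrs
      have hcomp : ((rename (Fin.castLE hsn) : MvPolynomial (Fin (s + 1)) K →ₐ[K] _).toRingHom).comp
          (rename Fin.castSucc : MvPolynomial (Fin s) K →ₐ[K] _).toRingHom =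
          (rename (Fin.castLE (by omega)) : MvPolynomial (Fin s) K →ₐ[K] _).toRingHom := by
        ext <;> simp
      have hcomp' : ((rename (Fin.castLE hsn) : MvPolynomial (Fin (s + 1)) K →ₐ[K] _).toRingHom).comp
          ((rename Fin.castSucc : MvPolynomial (Fin s) K →ₐ[K] _).toRingHom.comp
          (rename (Fin.castLE hrs) : MvPolynomial (Fin r) K →ₐ[K] _).toRingHom) =
          (rename (Fin.castLE hr) : MvPolynomial (Fin r) K →ₐ[K] _).toRingHom := by
        ext <;> simp
      have hg' : Polynomial.eval₂ (rename Fin.castSucc).toRingHom (X (Fin.last s))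
          (g.map (rename (Fin.castLE hrs)).toRingHom) ∈
          P.comap (rename (Fin.castLE hsn) : MvPolynomial (Fin (s + 1)) K →ₐ[K] _).toRingHom := by
        rw [Ideal.mem_comap, Polynomial.hom_eval₂, Polynomial.eval₂_map, RingHom.comp_assoc, hcomp']
        convert hgP
        simp
        rfl
      have h := Ideal.height_comap_rename_castSucc_add_one_le
        (P.comap (rename (Fin.castLE hsn) : MvPolynomial (Fin (s + 1)) K →ₐ[K] _).toRingHom)
        (hg.map (rename (Fin.castLE hrs)).toRingHom) hg'
      rw [Ideal.comap_comap, hcomp] at h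
      have h1 : ((s + 1 - r + 1 : ℕ) : ℕ∞) = ((s - r + 1 : ℕ) : ℕ∞) + 1 := by
        norm_cast
        omega
      rw [h1]
      exact (add_le_add_left (ih (by omega)) 1).trans h
  have hid : (rename (Fin.castLE le_rfl) : MvPolynomial (Fin n) K →ₐ[K] _).toRingHom =
      RingHom.id _ := by
    ext <;> simp
  have h := key n hr le_rfl
  rwa [hid, Ideal.comap_id] at h

lemma MvPolynomial.natDegree_le_and_coeff_eval₂_linear {K R σ : Type*} [CommRing K] [CommRing R]
    (f : K →+* R) (u v : σ → R) (H : MvPolynomial σ K) :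
    (eval₂ (Polynomial.C.comp f) (fun k => Polynomial.C (u k) + Polynomial.C (v k) * Polynomial.X)
      H).natDegree ≤ H.totalDegree ∧
    (eval₂ (Polynomial.C.comp f) (fun k => Polynomial.C (u k) + Polynomial.C (v k) * Polynomial.X)
      H).coeff H.totalDegree = eval₂ f v (homogeneousComponent H.totalDegree H) := by
  set w : σ → Polynomial R := fun k => Polynomial.C (u k) + Polynomial.C (v k) * Polynomial.X
  have hw (k : σ) : (w k).natDegree ≤ 1 ∧ (w k).coeff 1 = v k := by
    constructor
    · have := Polynomial.natDegree_linear_le (a := v k) (b := u k)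
      rwa [add_comm] at this
    · simp [w, Polynomial.coeff_C]
  have hprod (d : σ →₀ ℕ) (s : Finset σ) :
      (∏ k ∈ s, w k ^ d k).natDegree ≤ ∑ k ∈ s, d k ∧
      (∏ k ∈ s, w k ^ d k).coeff (∑ k ∈ s, d k) = ∏ k ∈ s, v k ^ d k := by
    classical
    induction s using Finset.induction_on with
    | empty => simp
    | insert a s ha ih =>
      simp only [Finset.prod_insert ha, Finset.sum_insert ha]
      have h1 : (w a ^ d a).natDegree ≤ d a := by
        simpa using Polynomial.natDegree_pow_le_of_le (d a) (hw a).1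
      have h2 : (w a ^ d a).coeff (d a) = v a ^ d a := by
        simpa [(hw a).2] using Polynomial.coeff_pow_of_natDegree_le (m := d a) (hw a).1
      exact ⟨Polynomial.natDegree_mul_le_of_le h1 ih.1,
        by rw [Polynomial.coeff_mul_add_eq_of_natDegree_le h1 ih.1, h2, ih.2]⟩
  rw [eval₂_eq]
  constructor
  · refine Polynomial.natDegree_sum_le_of_forall_le _ _ fun d hd => ?_
    refine (Polynomial.natDegree_C_mul_le _ _).trans ?_
    exact (hprod d d.support).1.trans (le_totalDegree hd)
  · rw [homogeneousComponent_apply, eval₂_sum, Finset.sum_filter, Polynomial.finsetSum_coeff]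
    refine Finset.sum_congr rfl fun d hd => ?_
    rw [RingHom.comp_apply, Polynomial.coeff_C_mul]
    split_ifs with h
    · rw [eval₂_monomial, ← h]
      exact congrArg _ (hprod d d.support).2
    · rw [Polynomial.coeff_eq_zero_of_natDegree_lt, mul_zero]
      exact (hprod d d.support).1.trans_lt ((le_totalDegree hd).lt_of_ne h)

lemma MvPolynomial.homogeneousComponent_totalDegree_ne_zero {K σ : Type*} [CommRing K]
    {H : MvPolynomial σ K} (hH : H ≠ 0) : homogeneousComponent H.totalDegree H ≠ 0 := by
  obtain ⟨d, hd, hdeg⟩ := Finset.exists_mem_eq_sup H.support (support_nonempty.2 hH)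
    (fun d => d.sum fun _ e => e)
  have : d.degree = H.totalDegree := hdeg.symm
  intro h
  have := congrArg (coeff d) h
  rw [coeff_homogeneousComponent, if_pos ‹_›, coeff_zero] at this
  exact (mem_support_iff.1 hd) this

lemma MvPolynomial.IsHomogeneous.eval_mul {K σ : Type*} [CommRing K] {T : MvPolynomial σ K} {D : ℕ}
    (hT : T.IsHomogeneous D) (t : K) (x : σ → K) :
    eval (fun k => t * x k) T = t ^ D * eval x T := by
  rw [eval_eq, eval_eq, Finset.mul_sum]
  refine Finset.sum_congr rfl fun d hd => ?_
  have : d.degree = D := by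
    rw [Finsupp.degree_eq_weight_one]
    exact hT (mem_support_iff.1 hd)
  simp only [mul_pow, Finset.prod_mul_distrib, Finset.prod_pow_eq_pow_sum]
  rw [← this, Finsupp.degree]
  ring!

lemma MvPolynomial.IsHomogeneous.exists_eval_snoc_one_ne_zero {k K : Type*} [Field k] [Infinite k]
    [Field K] [Algebra k K] {r D : ℕ} {T : MvPolynomial (Fin (r + 1)) K}
    (hT : T.IsHomogeneous D) (hT0 : T ≠ 0) :
    ∃ c : Fin r → k,
      eval (Fin.snoc (α := fun _ => K) (fun j => algebraMap k K (c j)) 1) T ≠ 0 := by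
  by_contra! hcon
  refine mul_ne_zero hT0 (X_ne_zero (Fin.last r)) (funext_set
    (fun _ => Set.range (algebraMap k K))
    (fun _ => Set.infinite_range_of_injective (algebraMap k K).injective) fun x hx => ?_)
  choose y hy using fun j => hx j (Set.mem_univ j)
  simp only [map_mul, eval_X, map_zero, mul_eq_zero, or_iff_not_imp_right]
  intro hlast
  have h0 := hcon fun j => y j.castSucc / y (Fin.last r)
  have hx : x = fun j => x (Fin.last r) * (Fin.snoc (α := fun _ => K) (fun j : Fin r =>
      algebraMap k K (y j.castSucc / y (Fin.last r))) 1 : Fin (r + 1) → K) j := by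
    funext j
    refine Fin.lastCases ?_ (fun j => ?_) j
    · simp
    · simp only [Fin.snoc_castSucc, map_div₀, hy]
      field_simp
  rw [hx, hT.eval_mul, h0, mul_zero]

/-- After a suitable shear, a nonzero polynomial becomes monic in its last variable. -/
lemma MvPolynomial.exists_monic_shear {k K : Type*} [Field k] [Infinite k] [Field K] [Algebra k K]
    {r : ℕ} {H : MvPolynomial (Fin (r + 1)) K} (hH : H ≠ 0) :
    ∃ c : Fin r → k, ∀ s : K →ₐ[k] K, ∃ a : K,
      (Polynomial.C (C a) * eval₂ (Polynomial.C.comp (C.comp (s : K →+* K)))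
        (Fin.snoc (α := fun _ => Polynomial (MvPolynomial (Fin r) K))
          (fun j => Polynomial.C (X j) +
            Polynomial.C (C (algebraMap k K (c j))) * Polynomial.X) Polynomial.X) H).Monic := by
  obtain ⟨c, hc⟩ := (homogeneousComponent_isHomogeneous H.totalDegree
    H).exists_eval_snoc_one_ne_zero (k := k) (homogeneousComponent_totalDegree_ne_zero hH)
  set w : Fin (r + 1) → K := Fin.snoc (α := fun _ => K) (fun j => algebraMap k K (c j)) 1
  set z := eval w (homogeneousComponent H.totalDegree H)
  refine ⟨c, fun s => ⟨(s z)⁻¹, ?_⟩⟩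
  have hsnoc : (Fin.snoc (α := fun _ => Polynomial (MvPolynomial (Fin r) K)) (fun j =>
      Polynomial.C (X j) + Polynomial.C (C (algebraMap k K (c j))) * Polynomial.X) Polynomial.X) =
      fun j => Polynomial.C
        (Fin.snoc (α := fun _ => MvPolynomial (Fin r) K) X 0 j) +
        Polynomial.C (C (w j)) * Polynomial.X := by
    funext j
    refine Fin.lastCases ?_ (fun j => ?_) j <;> simp [w]
  obtain ⟨h1, h2⟩ := natDegree_le_and_coeff_eval₂_linear (C.comp (s : K →+* K))
    (Fin.snoc (α := fun _ => MvPolynomial (Fin r) K) X 0) (fun j => C (w j)) H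
  rw [hsnoc]
  have h3 : eval₂ (C.comp (s : K →+* K)) (fun j => C (w j)) (homogeneousComponent H.totalDegree H)
      = (C (s z) : MvPolynomial (Fin r) K) := by
    have hs (j) : s (w j) = w j := by
      refine Fin.lastCases ?_ (fun j => ?_) j <;> simp [w]
    have := eval₂_comp_left (C.comp (s : K →+* K) : K →+* MvPolynomial (Fin r) K) (RingHom.id K) w
      (homogeneousComponent H.totalDegree H)
    simp only [RingHom.comp_id, Function.comp_def, RingHom.comp_apply, RingHom.coe_coe, hs] at this
    exact this.symm
  refine Polynomial.monic_of_natDegree_le_of_coeff_eq_one H.totalDegree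
    ((Polynomial.natDegree_C_mul_le _ _).trans h1) ?_
  rw [Polynomial.coeff_C_mul, h2, h3, ← C_mul, inv_mul_cancel₀, C_1]
  simpa using hc

section GenericChange

variable {n p : ℕ}

/-- The coordinates of `𝔄 · X`. -/
def genCoord (n : ℕ) (k : Fin n) : MvPolynomial (Fin n) (GenField n) :=
  ∑ m : Fin n, C (genEntry n k m) * X m

/-- `genChange` as a ring homomorphism. -/
def genChangeHom (n : ℕ) : MvPolynomial (Fin n) ℤ →+* MvPolynomial (Fin n) (GenField n) :=
  (aeval (genCoord n) : MvPolynomial (Fin n) (GenField n) →ₐ[GenField n] _).toRingHom.comp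
    (map (Int.castRingHom (GenField n)))

lemma genChange_eq (f : MvPolynomial (Fin n) ℤ) : genChange f = genChangeHom n f := rfl

lemma genChangeHom_X (k : Fin n) : genChangeHom n (X k) = genCoord n k := by
  simp [genChangeHom]

lemma pderiv_genCoord (k m : Fin n) : pderiv m (genCoord n k) = C (genEntry n k m) := by
  classical
  simp [genCoord, pderiv_X, Pi.single_apply]

lemma pderiv_genChangeHom (f : MvPolynomial (Fin n) ℤ) (m : Fin n) :
    pderiv m (genChangeHom n f) = ∑ k, genChangeHom n (pderiv k f) * C (genEntry n k m) := by
  classical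
  induction f using MvPolynomial.induction_on with
  | C a => simp [genChangeHom]
  | add f g hf hg => simp [hf, hg, add_mul, Finset.sum_add_distrib]
  | mul_X f k hf =>
    simp only [map_mul, Derivation.leibniz, genChangeHom_X, pderiv_genCoord, hf, pderiv_X,
      smul_eq_mul, map_add, add_mul, Finset.sum_add_distrib, Finset.mul_sum]
    congr 1
    · simp [Pi.single_apply, apply_ite (genChangeHom n)]
    · exact Finset.sum_congr rfl fun j _ => by ring

/-- The substitution `𝔄_{k,t} ↦ 𝔄_{k,t} - ∑ c_l 𝔄_{k,l}` on polynomials in the entries. -/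
def entryShearPoly (t : Fin n) (c : Fin n → ℂ) :
    MvPolynomial (Fin n × Fin n) ℂ →ₐ[ℂ] MvPolynomial (Fin n × Fin n) ℂ :=
  aeval fun q => X q - if q.2 = t then ∑ l, C (c l) * X (q.1, l) else 0

lemma entryShearPoly_injective {t : Fin n} {c : Fin n → ℂ} (hc : c t = 0) :
    Function.Injective (entryShearPoly t c) := by
  refine Function.LeftInverse.injective (g := entryShearPoly t (-c)) fun q => ?_
  rw [← AlgHom.comp_apply]
  refine (DFunLike.congr_fun (?_ : (entryShearPoly t (-c)).comp (entryShearPoly t c) =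
    AlgHom.id ℂ _) q)
  ext ⟨k, m⟩ : 1
  have h (l : Fin n) : C (c l) * entryShearPoly t (-c) (X (k, l)) = C (c l) * X (k, l) := by
    by_cases hl : l = t
    · simp [hl, hc]
    · simp [entryShearPoly, hl]
  have h' (l : Fin n) : entryShearPoly t (-c) (C (c l)) = C (c l) := algHom_C _ _
  by_cases hm : m = t
  · subst hm
    have : entryShearPoly m c (X (k, m)) = X (k, m) - ∑ l, C (c l) * X (k, l) := by
      simp [entryShearPoly]
    rw [AlgHom.comp_apply, this, map_sub, map_sum]
    simp only [map_mul, h, h']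
    simp [entryShearPoly]
  · simp [entryShearPoly, hm]

/-- The extension of `entryShearPoly` to the field `K`. -/
def entryShear (t : Fin n) (c : Fin n → ℂ) (hc : c t = 0) : GenField n →ₐ[ℂ] GenField n :=
  IsFractionRing.liftAlgHom (A := MvPolynomial (Fin n × Fin n) ℂ) (K := GenField n)
    (g := (IsScalarTower.toAlgHom ℂ (MvPolynomial (Fin n × Fin n) ℂ) (GenField n)).comp
      (entryShearPoly t c))
    (by
      rw [AlgHom.coe_comp]
      exact (IsFractionRing.injective _ (GenField n)).comp (entryShearPoly_injective hc))

lemma entryShear_genEntry (t : Fin n) (c : Fin n → ℂ) (hc : c t = 0) (k m : Fin n) :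
    entryShear t c hc (genEntry n k m) = genEntry n k m -
      if m = t then ∑ l, algebraMap ℂ (GenField n) (c l) * genEntry n k l else 0 := by
  rw [genEntry, entryShear, IsFractionRing.liftAlgHom_apply, IsFractionRing.lift_algebraMap]
  have hC (z : ℂ) : algebraMap (MvPolynomial (Fin n × Fin n) ℂ) (GenField n) (C z) =
      algebraMap ℂ (GenField n) z :=
    (IsScalarTower.algebraMap_apply ℂ (MvPolynomial (Fin n × Fin n) ℂ) (GenField n) z).symm
  simp only [AlgHom.toRingHom_eq_coe, RingHom.coe_coe, AlgHom.comp_apply,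
    IsScalarTower.coe_toAlgHom', entryShearPoly, aeval_X, map_sub]
  congr 1
  split_ifs <;> simp [hC, genEntry]

/-- The semilinear substitution `X_k ↦ X_k + c_k X_t` which leaves `𝔄 · X` fixed. -/
def shear (t : Fin n) (c : Fin n → ℂ) (hc : c t = 0) :
    MvPolynomial (Fin n) (GenField n) →+* MvPolynomial (Fin n) (GenField n) :=
  eval₂Hom (C.comp (entryShear t c hc : GenField n →+* GenField n))
    fun k => X k + C (algebraMap ℂ (GenField n) (c k)) * X t

lemma shear_C (t : Fin n) (c : Fin n → ℂ) (hc : c t = 0) (a : GenField n) :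
    shear t c hc (C a) = C (entryShear t c hc a) := by
  simp [shear]

lemma shear_X (t : Fin n) (c : Fin n → ℂ) (hc : c t = 0) (k : Fin n) :
    shear t c hc (X k) = X k + C (algebraMap ℂ (GenField n) (c k)) * X t := by
  simp [shear]

lemma shear_genCoord (t : Fin n) (c : Fin n → ℂ) (hc : c t = 0) (k : Fin n) :
    shear t c hc (genCoord n k) = genCoord n k := by
  set S := ∑ l, algebraMap ℂ (GenField n) (c l) * genEntry n k l
  have h (m : Fin n) : shear t c hc (C (genEntry n k m) * X m) = C (genEntry n k m) * X m +
      C (algebraMap ℂ (GenField n) (c m) * genEntry n k m) * X t -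
      if m = t then C S * X t else 0 := by
    rw [map_mul, shear_C, shear_X, entryShear_genEntry]
    split_ifs with hm
    · subst hm
      simp only [hc, map_zero, map_sub, map_mul]
      ring
    · simp only [map_mul, sub_zero]
      ring
  rw [genCoord, map_sum, Finset.sum_congr rfl fun m _ => h m, Finset.sum_sub_distrib,
    Finset.sum_add_distrib, ← Finset.sum_mul, ← map_sum]
  simp [S]

lemma shear_genChangeHom (t : Fin n) (c : Fin n → ℂ) (hc : c t = 0)
    (f : MvPolynomial (Fin n) ℤ) : shear t c hc (genChangeHom n f) = genChangeHom n f := by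
  induction f using MvPolynomial.induction_on with
  | C a => simp [genChangeHom]
  | add f g hf hg => simp [hf, hg]
  | mul_X f k hf => simp [hf, genChangeHom_X, shear_genCoord]

lemma shear_pderiv_genChangeHom {t m : Fin n} (c : Fin n → ℂ) (hc : c t = 0)
    (hm : m ≠ t) (f : MvPolynomial (Fin n) ℤ) :
    shear t c hc (pderiv m (genChangeHom n f)) = pderiv m (genChangeHom n f) := by
  simp [pderiv_genChangeHom, shear_genChangeHom, shear_C, entryShear_genEntry, hm]

lemma polarIdealK_le_comap_shear (F : Fin p → MvPolynomial (Fin n) ℤ) {i : ℕ} {t : Fin n}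
    (c : Fin n → ℂ) (hc : c t = 0) (hti : (t : ℕ) < i) :
    polarIdealK (fun j => genChange (F j)) i ≤
      (polarIdealK (fun j => genChange (F j)) i).comap (shear t c hc) := by
  refine Ideal.span_le.2 ?_
  rintro _ (⟨j, rfl⟩ | ⟨e, rfl⟩)
  · simp only [SetLike.mem_coe, Ideal.mem_comap, genChange_eq, shear_genChangeHom]
    exact Ideal.subset_span (Or.inl ⟨j, rfl⟩)
  · rw [SetLike.mem_coe, Ideal.mem_comap, RingHom.map_det]
    refine Ideal.subset_span (Or.inr ⟨e, congrArg _ ?_⟩)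
    ext1 a b
    refine shear_pderiv_genChangeHom c hc (fun h => ?_) (F a)
    have := congrArg Fin.val h
    simp only [colIdx] at this
    omega

lemma exists_monic_mem_radical (F : Fin p → MvPolynomial (Fin n) ℤ) {i r : ℕ} (hr : r + 1 ≤ n)
    (hri : r + 1 ≤ i) {H : MvPolynomial (Fin (r + 1)) (GenField n)} (hH : H ≠ 0)
    (hmem : rename (Fin.castLE hr) H ∈ (polarIdealK (fun j => genChange (F j)) i).radical) :
    ∃ Q : Polynomial (MvPolynomial (Fin r) (GenField n)), Q.Monic ∧
      Polynomial.eval₂ (rename (Fin.castLE (Nat.le_of_succ_le hr))).toRingHom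
        (X (⟨r, hr⟩ : Fin n)) Q ∈ (polarIdealK (fun j => genChange (F j)) i).radical := by
  obtain ⟨c', hc'⟩ := exists_monic_shear (k := ℂ) hH
  let c : Fin n → ℂ := fun m => if h : (m : ℕ) < r then c' ⟨m, h⟩ else 0
  have hc : c ⟨r, hr⟩ = 0 := by simp [c]
  obtain ⟨a, ha⟩ := hc' (entryShear ⟨r, hr⟩ c hc)
  refine ⟨_, ha, ?_⟩
  rw [Polynomial.eval₂_mul]
  refine Ideal.mul_mem_left _ _ ?_
  have hcomp : (Polynomial.eval₂RingHom (rename (Fin.castLE (Nat.le_of_succ_le hr)) :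
        MvPolynomial (Fin r) (GenField n) →ₐ[GenField n] _).toRingHom
        (X (⟨r, hr⟩ : Fin n))).comp
      (eval₂Hom (Polynomial.C.comp (C.comp (entryShear ⟨r, hr⟩ c hc : GenField n →+* GenField n)))
        (Fin.snoc (α := fun _ => Polynomial (MvPolynomial (Fin r) (GenField n)))
          (fun j => Polynomial.C (X j) +
            Polynomial.C (C (algebraMap ℂ (GenField n) (c' j))) * Polynomial.X) Polynomial.X)) =
      (shear ⟨r, hr⟩ c hc).comp (rename (Fin.castLE hr) :
        MvPolynomial (Fin (r + 1)) (GenField n) →ₐ[GenField n] _).toRingHom := by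
    refine ringHom_ext (fun a => ?_) fun j => ?_
    · simp [shear_C]
    · refine Fin.lastCases ?_ (fun j => ?_) j
      · have : Fin.castLE hr (Fin.last r) = ⟨r, hr⟩ := rfl
        simp [shear_X, this, hc]
      · have : Fin.castLE hr j.castSucc = Fin.castLE (Nat.le_of_succ_le hr) j := rfl
        simp [shear_X, this, c]
  have h := DFunLike.congr_fun hcomp H
  simp only [RingHom.comp_apply, Polynomial.coe_eval₂RingHom, coe_eval₂Hom] at h
  rw [h]
  have hle := Ideal.radical_mono (polarIdealK_le_comap_shear F c hc hri)
  rw [← Ideal.comap_radical] at hle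
  exact hle hmem

lemma MvPolynomial.aeval_eq_zero_of_forall_eval_eq_zero {σ k L : Type*} [Finite σ] [Field k]
    [IsAlgClosed k] [Field L] [Algebra k L] {S : Set (MvPolynomial σ k)} {g : MvPolynomial σ k}
    (h : ∀ x : σ → k, (∀ s ∈ S, eval x s = 0) → eval x g = 0) {z : σ → L}
    (hz : ∀ s ∈ S, aeval z s = 0) : aeval z g = 0 := by
  have hg : g ∈ (Ideal.span S).radical := by
    rw [← vanishingIdeal_zeroLocus_eq_radical (K := k), zeroLocus_span]
    exact fun x hx => by simpa using h x fun s hs => by simpa using hx s hs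
  have hz' : z ∈ zeroLocus L (Ideal.span S) := by
    rw [zeroLocus_span]
    exact hz
  exact radical_le_vanishingIdeal_zeroLocus (K := L) _ hg z hz'

lemma eq_zero_of_vecMul_jacobian_eq_zero {L : Type*} [Field L] [Algebra ℂ L]
    (f : Fin p → MvPolynomial (Fin n) ℂ)
    (hsm : ∀ x : Fin n → ℂ, (∀ j, eval x (f j) = 0) → (jacEval f x).rank = p)
    {y : Fin n → L} (hy : ∀ j, aeval y (f j) = 0) {l : Fin p → L}
    (hl : ∀ k, ∑ a, l a * aeval y (pderiv k (f a)) = 0) : l = 0 := by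
  funext a
  let S : Set (MvPolynomial (Fin n ⊕ Fin p) ℂ) := Set.range (fun j => rename Sum.inl (f j)) ∪
    Set.range fun k => ∑ a, X (Sum.inr a) * rename Sum.inl (pderiv k (f a))
  have h := aeval_eq_zero_of_forall_eval_eq_zero (S := S) (g := X (Sum.inr a)) (L := L)
    (z := Sum.elim y l) (fun x hx => ?_) ?_
  · simpa using h
  · have h1 (j : Fin p) : eval (x ∘ Sum.inl) (f j) = 0 := by
      simpa [eval_rename] using hx _ (Or.inl ⟨j, rfl⟩)
    have h2 : Matrix.vecMul (x ∘ Sum.inr) (jacEval f (x ∘ Sum.inl)) = 0 := by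
      funext k
      simpa [eval_rename, Matrix.vecMul, dotProduct, jacEval] using hx _ (Or.inr ⟨k, rfl⟩)
    have h3 : LinearIndependent ℂ (jacEval f (x ∘ Sum.inl)).row := by
      rw [linearIndependent_iff_card_eq_finrank_span, Set.finrank, ← Matrix.rank_eq_finrank_span_row,
        hsm _ h1, Fintype.card_fin]
    have h4 := Matrix.vecMul_injective_iff.2 h3 (h2.trans (Matrix.zero_vecMul _).symm)
    simpa using congrFun h4 a
  · rintro _ (⟨j, rfl⟩ | ⟨k, rfl⟩)
    · simpa [aeval_rename] using hy j
    · simpa [aeval_rename] using hl k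

lemma det_genEntry_ne_zero (n : ℕ) : (Matrix.of (genEntry n)).det ≠ 0 := by
  have : Matrix.of (genEntry n) = (Matrix.mvPolynomialX (Fin n) (Fin n) ℂ).map
      (algebraMap _ (GenField n)) := by
    ext k m
    simp [genEntry]
  rw [this, ← RingHom.mapMatrix_apply, ← RingHom.map_det]
  exact (map_ne_zero_iff _ (IsFractionRing.injective _ _)).2 (Matrix.det_mvPolynomialX_ne_zero _ _)

lemma pderiv_toC (f : MvPolynomial (Fin n) ℤ) (k : Fin n) : pderiv k (toC f) = toC (pderiv k f) :=
  pderiv_map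

lemma eq_zero_of_vecMul_genChange_jacobian_eq_zero {L : Type*} [Field L]
    (F : Fin p → MvPolynomial (Fin n) ℤ)
    (hsm : ∀ x : Fin n → ℂ, (∀ j, eval x (toC (F j)) = 0) →
      (jacEval (fun j => toC (F j)) x).rank = p)
    (φ : MvPolynomial (Fin n) (GenField n) →+* L) (hφ : ∀ j, φ (genChange (F j)) = 0)
    {l : Fin p → L} (hl : ∀ m, ∑ a, l a * φ (pderiv m (genChange (F a))) = 0) : l = 0 := by
  let : Algebra ℂ L := ((φ.comp C).comp (algebraMap ℂ (GenField n))).toAlgebra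
  have hcomp (f : MvPolynomial (Fin n) ℤ) :
      φ (genChangeHom n f) = aeval (fun k => φ (genCoord n k)) (toC f) := by
    refine DFunLike.congr_fun (?_ : φ.comp (genChangeHom n) =
      ((aeval fun k => φ (genCoord n k) : MvPolynomial (Fin n) ℂ →ₐ[ℂ] L) :
        MvPolynomial (Fin n) ℂ →+* L).comp (map (Int.castRingHom ℂ))) f
    refine ringHom_ext (fun a => by simp) fun k => by simp [genChangeHom_X]
  refine eq_zero_of_vecMul_jacobian_eq_zero (fun j => toC (F j)) hsm
    (y := fun k => φ (genCoord n k)) (fun j => (hcomp _).symm.trans (hφ j)) ?_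
  refine congrFun (Matrix.eq_zero_of_vecMul_eq_zero
    (M := (Matrix.of (genEntry n)).map (φ.comp C)) ?_ ?_)
  · rw [← RingHom.mapMatrix_apply, ← RingHom.map_det]
    exact (map_ne_zero_iff _ (RingHom.injective _)).2 (det_genEntry_ne_zero n)
  · funext m
    rw [Pi.zero_apply, ← hl m]
    simp only [Matrix.vecMul, dotProduct, pderiv_toC, ← hcomp, genChange_eq, pderiv_genChangeHom,
      map_sum, Finset.mul_sum, Finset.sum_mul, map_mul, Matrix.map_apply, Matrix.of_apply,
      RingHom.comp_apply, mul_assoc]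
    exact Finset.sum_comm

lemma Derivation.apply_algHom_mvPolynomial {K L σ : Type*} [CommRing K] [CommRing L] [Algebra K L]
    [Fintype σ] (D : Derivation K L L) (φ : MvPolynomial σ K →ₐ[K] L) (g : MvPolynomial σ K) :
    D (φ g) = ∑ k, φ (pderiv k g) * D (φ (X k)) := by
  classical
  induction g using MvPolynomial.induction_on with
  | C a =>
    rw [algHom_C]
    simp
  | add f g hf hg => simp [hf, hg, add_mul, Finset.sum_add_distrib]
  | mul_X f k hf =>
    simp only [map_mul, Derivation.leibniz, hf, pderiv_X, smul_eq_mul, map_add, add_mul,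
      Finset.sum_add_distrib, Finset.mul_sum]
    congr 1
    · simp [Pi.single_apply, apply_ite φ]
    · exact Finset.sum_congr rfl fun j _ => by ring

lemma comap_rename_ne_bot_of_polarIdealK_le (F : Fin p → MvPolynomial (Fin n) ℤ)
    (hsm : ∀ x : Fin n → ℂ, (∀ j, eval x (toC (F j)) = 0) →
      (jacEval (fun j => toC (F j)) x).rank = p)
    {i : ℕ} (hi : i ≤ n) (P : Ideal (MvPolynomial (Fin n) (GenField n))) [P.IsPrime]
    (hP : polarIdealK (fun j => genChange (F j)) i ≤ P) :
    ∃ H : MvPolynomial (Fin i) (GenField n), H ≠ 0 ∧ rename (Fin.castLE hi) H ∈ P := by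
  by_contra! hcon
  let L := FractionRing (MvPolynomial (Fin n) (GenField n) ⧸ P)
  let φ : MvPolynomial (Fin n) (GenField n) →ₐ[GenField n] L :=
    (IsScalarTower.toAlgHom (GenField n) (MvPolynomial (Fin n) (GenField n) ⧸ P) L).comp
      (Ideal.Quotient.mkₐ (GenField n) P)
  have hφ (g) : φ g = 0 ↔ g ∈ P :=
    (map_eq_zero_iff (algebraMap (MvPolynomial (Fin n) (GenField n) ⧸ P) L)
      (IsFractionRing.injective _ _)).trans Ideal.Quotient.eq_zero_iff_mem
  let x : Fin i → L := fun m => φ (X (Fin.castLE hi m))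
  have hx : AlgebraicIndependent (GenField n) x := by
    rw [algebraicIndependent_iff]
    intro q hq
    by_contra hq0
    refine hcon q hq0 ((hφ _).1 ?_)
    rw [← hq]
    exact DFunLike.congr_fun (algHom_ext (f := φ.comp (rename (Fin.castLE hi))) (g := aeval x)
      fun m => by simp [x]) q
  have hG (j) : φ (genChange (F j)) = 0 := (hφ _).2 (hP (Ideal.subset_span (Or.inl ⟨j, rfl⟩)))
  obtain ⟨l, hl0, hl⟩ := exists_vecMul_eq_zero_of_minors
    (Matrix.of fun (a : Fin p) (b : Fin (n - i)) => φ (pderiv (colIdx n i b) (genChange (F a))))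
    fun c => by
      have := (hφ _).2 (hP (Ideal.subset_span (Or.inr ⟨c, rfl⟩)))
      rwa [AlgHom.map_det] at this
  refine hl0 (eq_zero_of_vecMul_genChange_jacobian_eq_zero F hsm (φ : _ →+* L) hG ?_)
  have hge (m : Fin n) (hm : i ≤ m) : ∑ a, l a * φ (pderiv m (genChange (F a))) = 0 := by
    have hm' : colIdx n i ⟨m - i, by omega⟩ = m := Fin.ext (by simp [colIdx]; omega)
    have := congrFun hl ⟨m - i, by omega⟩
    simpa [Matrix.vecMul, dotProduct, hm'] using this
  intro m
  by_cases hm : i ≤ m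
  · exact hge m hm
  obtain ⟨D, hD⟩ := hx.exists_derivation (Pi.single ⟨m, not_le.1 hm⟩ 1)
  have h1 : ∑ k, (∑ a, l a * φ (pderiv k (genChange (F a)))) * D (φ (X k)) = 0 := by
    have h2 (a : Fin p) : ∑ k, φ (pderiv k (genChange (F a))) * D (φ (X k)) = 0 := by
      rw [← D.apply_algHom_mvPolynomial, hG, map_zero]
    calc _ = ∑ k, ∑ a, l a * (φ (pderiv k (genChange (F a))) * D (φ (X k))) :=
          Finset.sum_congr rfl fun k _ =>
            (Finset.sum_mul ..).trans (Finset.sum_congr rfl fun a _ => mul_assoc ..)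
      _ = ∑ a, ∑ k, l a * (φ (pderiv k (genChange (F a))) * D (φ (X k))) := Finset.sum_comm
      _ = 0 := Finset.sum_eq_zero fun a _ => by rw [← Finset.mul_sum, h2, mul_zero]
  rw [Finset.sum_eq_single m] at h1
  · have h3 : D (φ (X m)) = 1 := by
      have := hD ⟨m, not_le.1 hm⟩
      rwa [Pi.single_eq_same] at this
    rwa [h3, mul_one] at h1
  · intro k _ hk
    by_cases hk' : i ≤ k
    · rw [hge k hk', zero_mul]
    · have h3 : D (φ (X k)) = 0 := by
        have := hD ⟨k, not_le.1 hk'⟩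
        rwa [Pi.single_eq_of_ne fun h => hk (Fin.ext (Fin.mk.inj h))] at this
      rw [h3, mul_zero]
  · simp

lemma Ideal.exists_ne_zero_mem_radical {R S : Type*} [CommRing R] [IsDomain R] [CommRing S]
    [IsNoetherianRing S] (f : R →+* S) (I : Ideal S)
    (h : ∀ P : Ideal S, P.IsPrime → I ≤ P → ∃ a, a ≠ 0 ∧ f a ∈ P) :
    ∃ a, a ≠ 0 ∧ f a ∈ I.radical := by
  choose! a ha0 ha using h
  have hfin := I.finite_minimalPrimes_of_isNoetherianRing
  refine ⟨∏ P ∈ hfin.toFinset, a P, Finset.prod_ne_zero_iff.2 fun P hP => ?_, ?_⟩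
  · have hP := hfin.mem_toFinset.1 hP
    exact ha0 P hP.isPrime hP.le
  · rw [← Ideal.sInf_minimalPrimes, Ideal.mem_sInf]
    intro P hP
    rw [map_prod]
    exact Ideal.mem_of_dvd _ (Finset.dvd_prod_of_mem _ (hfin.mem_toFinset.2 hP))
      (ha P hP.isPrime hP.le)

lemma RingHom.isIntegral_of_forall_isIntegralElem_comp {A B S : Type*} [CommRing A] [CommRing B]
    [CommRing S] (f : A →+* S) (h : B →+* S) (hS : h.IsIntegral)
    (hB : ∀ b, f.IsIntegralElem (h b)) : f.IsIntegral := by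
  algebraize [f]
  intro s
  obtain ⟨q, hq, hqs⟩ := hS s
  let h' : B →+* integralClosure A S := h.codRestrict (integralClosure A S) hB
  refine isIntegral_trans (A := integralClosure A S) s ⟨q.map h', hq.map h', ?_⟩
  rw [Polynomial.eval₂_map, ← hqs]
  rfl

lemma MvPolynomial.isIntegral_comp_rename_castLE {K S : Type*} [CommRing K] [CommRing S] {n r : ℕ}
    (hr : r + 1 ≤ n) (g : MvPolynomial (Fin n) K →+* S)
    (hg : (g.comp (rename (Fin.castLE hr)).toRingHom).IsIntegral)
    (hX : (g.comp (rename (Fin.castLE (Nat.le_of_succ_le hr))).toRingHom).IsIntegralElem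
      (g (X ⟨r, hr⟩))) :
    (g.comp (rename (Fin.castLE (Nat.le_of_succ_le hr))).toRingHom).IsIntegral := by
  refine RingHom.isIntegral_of_forall_isIntegralElem_comp _ _ hg fun b => ?_
  induction b using MvPolynomial.induction_on with
  | C a =>
    convert RingHom.isIntegralElem_map _ (x := C a) using 1
    simp
  | add a b ha hb =>
    rw [map_add]
    exact ha.add _ hb
  | mul_X a k ha =>
    rw [map_mul]
    refine ha.mul _ ?_
    induction k using Fin.lastCases with
    | last => simpa [Fin.castLE] using hX
    | cast k =>
      convert RingHom.isIntegralElem_map _ (x := X k) using 1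
      simp

lemma polarIdealK_succ_le {R : Type*} [CommRing R] (G : Fin p → MvPolynomial (Fin n) R) (i : ℕ) :
    polarIdealK G (i + 1) ≤ polarIdealK G i := by
  refine Ideal.span_mono (Set.union_subset_union_right _ ?_)
  rintro _ ⟨c, rfl⟩
  refine ⟨⟨fun a => ⟨c a + 1, by have := (c a).2; omega⟩,
    fun a b hab => c.injective (Fin.ext (Nat.succ.inj (congrArg Fin.val hab)))⟩, ?_⟩
  congr! 6 with a b
  exact Fin.ext (Nat.succ_add_eq_add_succ i (c b))

theorem isIntegral_quotient_radical_polarIdealK (F : Fin p → MvPolynomial (Fin n) ℤ)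
    (hsm : ∀ x : Fin n → ℂ, (∀ j, eval x (toC (F j)) = 0) →
      (jacEval (fun j => toC (F j)) x).rank = p) {r : ℕ} (hr : r ≤ n) :
    ((Ideal.Quotient.mk (polarIdealK (fun j => genChange (F j)) (r + 1)).radical).comp
      (rename (Fin.castLE hr)).toRingHom).IsIntegral := by
  induction hr using Nat.decreasingInduction with
  | self =>
    refine RingHom.isIntegral_of_surjective _ (Ideal.Quotient.mk_surjective.comp ?_)
    intro q
    exact ⟨q, by simp⟩
  | of_succ r hr ih =>
    set I := polarIdealK (fun j => genChange (F j)) (r + 1)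
    have hle : (polarIdealK (fun j => genChange (F j)) (r + 1 + 1)).radical ≤ I.radical :=
      Ideal.radical_mono (polarIdealK_succ_le _ _)
    refine isIntegral_comp_rename_castLE hr _ ?_ ?_
    · have := ih.trans _ (Ideal.Quotient.factor hle)
        (RingHom.isIntegral_of_surjective _ (Ideal.Quotient.factor_surjective hle))
      rwa [← RingHom.comp_assoc, Ideal.Quotient.factor_comp_mk] at this
    · obtain ⟨H, hH0, hH⟩ := Ideal.exists_ne_zero_mem_radical (rename (Fin.castLE hr)).toRingHom I
        fun P _ hP => comap_rename_ne_bot_of_polarIdealK_le F hsm hr P hP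
      obtain ⟨Q, hQ, hQI⟩ := exists_monic_mem_radical F hr le_rfl hH0 hH
      refine ⟨Q, hQ, ?_⟩
      rwa [← Polynomial.hom_eval₂, Ideal.Quotient.eq_zero_iff_mem]

lemma le_of_polarIdealK_le_isPrime (F : Fin p → MvPolynomial (Fin n) ℤ)
    (hsm : ∀ x : Fin n → ℂ, (∀ j, eval x (toC (F j)) = 0) →
      (jacEval (fun j => toC (F j)) x).rank = p)
    {i : ℕ} (P : Ideal (MvPolynomial (Fin n) (GenField n))) [P.IsPrime]
    (hP : polarIdealK (fun j => genChange (F j)) i ≤ P) : p ≤ n := by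
  by_contra! hpn
  have hG (j) : genChange (F j) ∈ P := hP (Ideal.subset_span (Or.inl ⟨j, rfl⟩))
  let φ := algebraMap (MvPolynomial (Fin n) (GenField n)) P.ResidueField
  obtain ⟨l, hl0, hl⟩ := exists_vecMul_eq_zero_of_minors
    (Matrix.of fun (a : Fin p) (m : Fin n) => φ (pderiv m (genChange (F a))))
    fun c => absurd (Fintype.card_le_of_embedding c) (by simpa using hpn)
  refine hl0 (eq_zero_of_vecMul_genChange_jacobian_eq_zero F hsm φ
    (fun j => Ideal.algebraMap_residueField_eq_zero.2 (hG j)) fun m => congrFun hl m)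

lemma height_le_of_mem_minimalPrimes_polarIdealK {K : Type*} [Field K]
    (G : Fin p → MvPolynomial (Fin n) K) {i : ℕ} {P : Ideal (MvPolynomial (Fin n) K)}
    (hP : P ∈ (polarIdealK G i).minimalPrimes) : P.height ≤ ((n - i + 1 - p + p : ℕ) : ℕ∞) := by
  have hPp : P.IsPrime := hP.isPrime
  have hGP : Set.range G ⊆ P := fun g hg => hP.le (Ideal.subset_span (Or.inl hg))
  set q := Ideal.Quotient.mk (Ideal.span (Set.range G))
  let M : Matrix (Fin p) (Fin (n - i)) (MvPolynomial (Fin n) K) :=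
    Matrix.of fun a b => pderiv (colIdx n i b) (G a)
  have hspan : polarIdealK G i = Ideal.span (Set.range G) ⊔ minorIdeal M := by
    rw [polarIdealK, Ideal.span_union, minorIdeal]
    congr 2
    ext g
    exact exists_congr fun c => eq_comm
  have hM : minorIdeal (M.map q) = (polarIdealK G i).map q := by
    rw [hspan, Ideal.map_sup, Ideal.map_quotient_self, bot_sup_eq, minorIdeal, minorIdeal,
      Ideal.map_span, ← Set.range_comp]
    congr 2
    funext c
    exact (RingHom.map_det q _).symm
  have hmin : P.map q ∈ (minorIdeal (M.map q)).minimalPrimes := by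
    rw [hM, Ideal.minimalPrimes_map_of_surjective Ideal.Quotient.mk_surjective, Ideal.mk_ker,
      sup_eq_left.2 (hspan ▸ le_sup_left)]
    exact ⟨P, hP, rfl⟩
  refine (Ideal.height_le_height_add_encard_of_subset (Set.range G) hGP).trans ?_
  rw [Nat.cast_add]
  refine add_le_add ?_ ?_
  · simpa using height_le_of_mem_minimalPrimes_minorIdeal _ hmin
  · rw [← Set.image_univ]
    exact (Set.encard_image_le _ _).trans (by simp)

end GenericChange

/-- with `𝒦 = ⟨𝔍(i, F^𝔄)⟩ ⊆ K[X₁,…,X_n]`, (a) for every variable `X_j`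
with `j ∈ {i,…,n}` there is a polynomial `Q_j ∈ K[X₁,…,X_{i−1},X_j]`, monic in `X_j`,
lying in `√𝒦`; and (b) every minimal prime `𝔓` over `𝒦` satisfies
`𝔓 ∩ K[X₁,…,X_{i−1}] = {0}`.  (Variables are `0`-indexed: `X₁,…,X_{i−1}` correspond
to `Fin (i−1)`, and `j ∈ {i,…,n}` to indices `j : Fin n` with `i − 1 ≤ j`.) -/
theorem generic_polar_noether_position
    (n p : ℕ) (hn : 0 < n) (hp : 0 < p)
    (F : Fin p → MvPolynomial (Fin n) ℤ)
    (hrad : (Ideal.span (Set.range fun j => toC (F j))).IsRadical)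
    (hequi : ∀ P ∈ (Ideal.span (Set.range fun j => toC (F j))).minimalPrimes,
      IdealHeightEq P p)
    (hsm : ∀ x : Fin n → ℂ, (∀ j, eval x (toC (F j)) = 0) →
      (jacEval (fun j => toC (F j)) x).rank = p)
    (i : ℕ) (hi1 : 1 ≤ i) (hi2 : i ≤ n - p + 1) :
    (∀ j : Fin n, i - 1 ≤ (j : ℕ) →
      ∃ Q : Polynomial (MvPolynomial (Fin (i - 1)) (GenField n)),
        Q.Monic ∧
        Polynomial.eval₂
          ((rename (Fin.castLE (show i - 1 ≤ n by omega) : Fin (i - 1) → Fin n)).toRingHom :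
            MvPolynomial (Fin (i - 1)) (GenField n) →+* MvPolynomial (Fin n) (GenField n))
          (X j) Q
          ∈ (polarIdealK (fun j => genChange (F j)) i).radical) ∧
    (∀ P ∈ (polarIdealK (fun j => genChange (F j)) i).minimalPrimes,
      Ideal.comap
        ((rename (Fin.castLE (show i - 1 ≤ n by omega) : Fin (i - 1) → Fin n)).toRingHom :
          MvPolynomial (Fin (i - 1)) (GenField n) →+* MvPolynomial (Fin n) (GenField n))
        P = ⊥) := by
  have hr : i - 1 ≤ n := by omega
  have hi : i - 1 + 1 = i := by omega
  have hmonic (j : Fin n) : ∃ Q : Polynomial (MvPolynomial (Fin (i - 1)) (GenField n)), Q.Monic ∧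
      Polynomial.eval₂ (rename (Fin.castLE hr)).toRingHom (X j) Q ∈
        (polarIdealK (fun j => genChange (F j)) i).radical := by
    have hint := isIntegral_quotient_radical_polarIdealK F hsm hr
    rw [hi] at hint
    obtain ⟨Q, hQ, hQ0⟩ := hint (Ideal.Quotient.mk _ (X j))
    refine ⟨Q, hQ, ?_⟩
    rwa [← Polynomial.hom_eval₂, Ideal.Quotient.eq_zero_iff_mem] at hQ0
  refine ⟨fun j _ => hmonic j, fun P hP => ?_⟩
  have hPp : P.IsPrime := hP.isPrime
  by_contra hne
  have hpn := le_of_polarIdealK_le_isPrime F hsm P hP.le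
  have hlow := Ideal.le_height_of_comap_rename_ne_bot hr P (fun j _ => by
    obtain ⟨Q, hQ, hQr⟩ := hmonic j
    exact ⟨Q, hQ, hPp.radical_le_iff.2 hP.le hQr⟩) hne
  have hlt := Nat.cast_le.1 (hlow.trans (height_le_of_mem_minimalPrimes_polarIdealK _ hP))
  omega

end
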